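/- Let 1 < c < 3/2 and ε > 0. For x ≥ 2 let E_c(x) denote the number of positive integers n ≤ x that cannot be represented in the form ⌊m^c⌋ + ⌊p^c⌋ = n with m a positive integer and p a prime. Then there is a constant C = C(c, ε) such that E_c(x) ≤ C · x^{3(1 - 1/c) + ε} for all x ≥ 2. -/

import Mathlib

section

open Real Finset MeasureTheory

/-- The additive character `t ↦ exp (2πit)`. -/
noncomputable def expTwoPi (t : ℝ) : ℂ := Complex.exp (2 * π * t * Complex.I)

lemma norm_expTwoPi (t : ℝ) : ‖expTwoPi t‖ = 1 := by
  have := Complex.norm_exp_ofReal_mul_I (2 * π * t)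
  rw [expTwoPi]
  exact_mod_cast this

lemma expTwoPi_add (s t : ℝ) : expTwoPi (s + t) = expTwoPi s * expTwoPi t := by
  rw [expTwoPi, expTwoPi, expTwoPi, ← Complex.exp_add]
  push_cast
  ring_nf

lemma expTwoPi_intCast (k : ℤ) : expTwoPi k = 1 := by
  rw [expTwoPi, Complex.exp_eq_one_iff]
  exact ⟨k, by push_cast; ring⟩

lemma expTwoPi_neg (t : ℝ) : expTwoPi (-t) = (starRingEnd ℂ) (expTwoPi t) := by
  rw [expTwoPi, expTwoPi, ← Complex.exp_conj]
  simp [map_ofNat]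

lemma continuous_expTwoPi : Continuous expTwoPi := by
  unfold expTwoPi
  fun_prop

lemma hasDerivAt_expTwoPi (t : ℝ) :
    HasDerivAt expTwoPi (2 * π * Complex.I * expTwoPi t) t := by
  have h : HasDerivAt (fun s : ℝ => (2 * π * s * Complex.I : ℂ)) (2 * π * Complex.I) t := by
    have := ((Complex.ofRealCLM.hasDerivAt (x := t)).const_mul (2 * π : ℂ)).mul_const Complex.I
    simpa using this
  have := h.cexp
  unfold expTwoPi
  convert this using 1
  ring

lemma norm_expTwoPi_sub_le (s t : ℝ) : ‖expTwoPi s - expTwoPi t‖ ≤ 2 * π * |s - t| := by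
  have := convex_univ.norm_image_sub_le_of_norm_hasDerivWithin_le
    (f := expTwoPi) (f' := fun t => 2 * π * Complex.I * expTwoPi t) (C := 2 * π)
    (fun x _ => (hasDerivAt_expTwoPi x).hasDerivWithinAt)
    (fun x _ => by simp [norm_expTwoPi, abs_of_pos pi_pos]) (Set.mem_univ t) (Set.mem_univ s)
  simpa using this

/-- The resolvent `1 / (1 - e(t))` in terms of the cotangent. -/
lemma one_sub_expTwoPi_mul {t : ℝ} (ht : sin (π * t) ≠ 0) :
    (1 - expTwoPi t) * ((1 + (cos (π * t) / sin (π * t) : ℝ) * Complex.I) / 2) = 1 := by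
  have h : expTwoPi t = (cos (π * t) + sin (π * t) * Complex.I) ^ 2 := by
    rw [expTwoPi, Complex.ofReal_cos, Complex.ofReal_sin, ← Complex.exp_mul_I, ← Complex.exp_nat_mul]
    push_cast
    ring_nf
  have h1 : ((cos (π * t) : ℝ) : ℂ) ^ 2 = 1 - ((sin (π * t) : ℝ) : ℂ) ^ 2 := by
    have := sin_sq_add_cos_sq (π * t)
    rw [eq_sub_iff_add_eq, add_comm]
    exact_mod_cast this
  have hs : ((sin (π * t) : ℝ) : ℂ) ≠ 0 := by exact_mod_cast ht
  rw [h]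
  push_cast [-Complex.ofReal_sin, -Complex.ofReal_cos]
  generalize ((sin (π * t) : ℝ) : ℂ) = s at *
  generalize ((cos (π * t) : ℝ) : ℂ) = k at *
  have hI := Complex.I_sq
  field_simp
  linear_combination (s - k * Complex.I) * h1 - (s ^ 3 + 2 * k ^ 2 * s + k * s ^ 2 * Complex.I) * hI

lemma two_mul_le_sin_pi_mul {t δ : ℝ} (hδ : 0 < δ) (h1 : δ ≤ t) (h2 : t ≤ 1 - δ) :
    2 * δ ≤ sin (π * t) := by
  have key : ∀ u : ℝ, δ ≤ u → u ≤ 1 / 2 → 2 * δ ≤ sin (π * u) := fun u hu hu' => by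
    have := mul_le_sin (x := π * u) (by nlinarith [pi_pos]) (by nlinarith [pi_pos])
    have h : 2 / π * (π * u) = 2 * u := by field_simp
    linarith
  rcases le_total t (1 / 2) with h | h
  · exact key t h1 h
  · have := key (1 - t) (by linarith) (by linarith)
    rwa [show π * (1 - t) = π - π * t by ring, sin_pi_sub] at this

lemma abs_cot_pi_mul_le {t δ : ℝ} (hδ : 0 < δ) (h1 : δ ≤ t) (h2 : t ≤ 1 - δ) :
    |cos (π * t) / sin (π * t)| ≤ 1 / (2 * δ) := by
  have h := two_mul_le_sin_pi_mul hδ h1 h2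
  rw [abs_div, abs_of_pos (by linarith : 0 < sin (π * t))]
  gcongr
  exact abs_cos_le_one _

lemma cot_pi_mul_antitone {s t δ : ℝ} (hδ : 0 < δ) (h1 : δ ≤ s) (hst : s ≤ t) (h2 : t ≤ 1 - δ) :
    cos (π * t) / sin (π * t) ≤ cos (π * s) / sin (π * s) := by
  have hs := two_mul_le_sin_pi_mul hδ h1 (hst.trans h2)
  have ht := two_mul_le_sin_pi_mul hδ (h1.trans hst) h2
  rw [div_le_div_iff₀ (by linarith) (by linarith)]
  have : 0 ≤ sin (π * t - π * s) :=
    sin_nonneg_of_nonneg_of_le_pi (by nlinarith [pi_pos]) (by nlinarith [pi_pos])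
  rw [sin_sub] at this
  linarith

/-- **Kusmin–Landau inequality**, normalized at the origin. -/
lemma norm_sum_range_expTwoPi_le (θ : ℕ → ℝ) (n : ℕ) {δ : ℝ} (hδ : 0 < δ)
    (hmono : ∀ m, m + 1 < n → θ (m + 1) - θ m ≤ θ (m + 2) - θ (m + 1))
    (hlow : ∀ m < n, δ ≤ θ (m + 1) - θ m) (hupp : ∀ m < n, θ (m + 1) - θ m ≤ 1 - δ) :
    ‖∑ m ∈ range n, expTwoPi (θ m)‖ ≤ 2 / δ := by
  set v : ℕ → ℝ := fun m => cos (π * (θ (m + 1) - θ m)) / sin (π * (θ (m + 1) - θ m)) with hv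
  set w : ℕ → ℂ := fun m => (1 + (v m : ℝ) * Complex.I) / 2 with hw
  have hvb : ∀ m < n, |v m| ≤ 1 / (2 * δ) := fun m hm =>
    abs_cot_pi_mul_le hδ (hlow m hm) (hupp m hm)
  have hδ2 : n ≠ 0 → δ ≤ 1 / 2 := fun hn => by
    have h0 := hlow 0 (by omega)
    have h1 := hupp 0 (by omega)
    linarith
  have hres : ∀ m < n, expTwoPi (θ m) + expTwoPi (θ (m + 1)) * w m = expTwoPi (θ m) * w m := by
    intro m hm
    have hs := two_mul_le_sin_pi_mul hδ (hlow m hm) (hupp m hm)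
    have h1 := one_sub_expTwoPi_mul (t := θ (m + 1) - θ m) (by linarith)
    have h2 : expTwoPi (θ (m + 1)) = expTwoPi (θ m) * expTwoPi (θ (m + 1) - θ m) := by
      rw [← expTwoPi_add]; ring_nf
    rw [h2]
    linear_combination (-expTwoPi (θ m)) * h1
  have hwb : ∀ m < n, ‖w m‖ ≤ 1 / (2 * δ) := by
    intro m hm
    have h1 : ‖(1 + (v m : ℝ) * Complex.I : ℂ)‖ ≤ 1 + |v m| :=
      (norm_add_le _ _).trans (by simp)
    have h2 : (1 : ℝ) ≤ 1 / (2 * δ) := by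
      rw [le_div_iff₀ (by linarith)]
      linarith [hδ2 (by omega)]
    rw [hw]
    simp only [norm_div, Complex.norm_ofNat]
    linarith [hvb m hm]
  have hind : ∀ k, k < n → ‖∑ m ∈ range (k + 1), expTwoPi (θ m) + expTwoPi (θ (k + 1)) * w k‖ ≤
      ‖w 0‖ + (v 0 - v k) / 2 := by
    intro k
    induction k with
    | zero =>
      intro hk
      simp [hres 0 hk, norm_expTwoPi]
    | succ k ih =>
      intro hk
      have h1 := ih (by omega)
      have h2 : ∑ m ∈ range (k + 1 + 1), expTwoPi (θ m) + expTwoPi (θ (k + 1 + 1)) * w (k + 1) =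
          (∑ m ∈ range (k + 1), expTwoPi (θ m) + expTwoPi (θ (k + 1)) * w k) +
            expTwoPi (θ (k + 1)) * (w (k + 1) - w k) := by
        rw [sum_range_succ _ (k + 1)]
        linear_combination hres (k + 1) hk
      have h3 : v (k + 1) ≤ v k :=
        cot_pi_mul_antitone hδ (hlow k (by omega)) (hmono k hk) (hupp (k + 1) hk)
      have h4 : ‖w (k + 1) - w k‖ = (v k - v (k + 1)) / 2 := by
        have : w (k + 1) - w k = ((v (k + 1) - v k : ℝ) : ℂ) * (Complex.I / 2) := by
          simp only [hw]
          push_cast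
          ring
        rw [this, norm_mul, Complex.norm_real, norm_eq_abs, abs_of_nonpos (by linarith)]
        simp
        ring
      rw [h2]
      refine (norm_add_le _ _).trans ?_
      rw [norm_mul, norm_expTwoPi, h4]
      linarith
  rcases n with _ | k
  · simp only [range_zero, sum_empty, norm_zero]
    positivity
  · have h1 := hind k (by omega)
    have h2 : ‖∑ m ∈ range (k + 1), expTwoPi (θ m)‖ ≤
        ‖∑ m ∈ range (k + 1), expTwoPi (θ m) + expTwoPi (θ (k + 1)) * w k‖ + ‖w k‖ := by
      have := norm_sub_le (∑ m ∈ range (k + 1), expTwoPi (θ m) + expTwoPi (θ (k + 1)) * w k)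
        (expTwoPi (θ (k + 1)) * w k)
      rwa [add_sub_cancel_right, norm_mul _ (w k), norm_expTwoPi, one_mul] at this
    have h3 := hwb 0 (by omega)
    have h4 := hwb k (by omega)
    have h5 := abs_le.mp (hvb 0 (by omega))
    have h6 := abs_le.mp (hvb k (by omega))
    have h7 : 2 / δ = 4 * (1 / (2 * δ)) := by field_simp; norm_num
    rw [h7]
    have : 0 < 1 / (2 * δ) := by positivity
    linarith

/-- **Kusmin–Landau inequality** on an interval, with differences near no integer. -/
lemma norm_sum_Ico_expTwoPi_le (θ : ℕ → ℝ) (a b : ℕ) (ν : ℤ) {δ : ℝ} (hδ : 0 < δ)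
    (hmono : ∀ m, a ≤ m → m + 1 < b → θ (m + 1) - θ m ≤ θ (m + 2) - θ (m + 1))
    (hlow : ∀ m, a ≤ m → m < b → ν + δ ≤ θ (m + 1) - θ m)
    (hupp : ∀ m, a ≤ m → m < b → θ (m + 1) - θ m ≤ ν + 1 - δ) :
    ‖∑ m ∈ Ico a b, expTwoPi (θ m)‖ ≤ 2 / δ := by
  have h := norm_sum_range_expTwoPi_le (fun m => θ (a + m) - ν * m) (b - a) hδ
    (fun m hm => by
      have := hmono (a + m) (by omega) (by omega)
      simp only [← add_assoc]
      push_cast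
      linarith)
    (fun m hm => by
      have := hlow (a + m) (by omega) (by omega)
      simp only [← add_assoc]
      push_cast
      linarith)
    (fun m hm => by
      have := hupp (a + m) (by omega) (by omega)
      simp only [← add_assoc]
      push_cast
      linarith)
  rw [sum_Ico_eq_sum_range]
  convert h using 3 with m
  have h1 : expTwoPi (-(ν * m)) = 1 := by
    have := expTwoPi_intCast (-(ν * m))
    exact_mod_cast this
  rw [sub_eq_add_neg, expTwoPi_add, h1, mul_one]

/-- A finite set of naturals closed under betweenness is an interval. -/
lemma exists_eq_Ico_of_ordConnected (s : Finset ℕ)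
    (hs : ∀ i ∈ s, ∀ k ∈ s, ∀ j, i ≤ j → j ≤ k → j ∈ s) : ∃ a b, s = Ico a b := by
  rcases s.eq_empty_or_nonempty with rfl | hne
  · exact ⟨0, 0, by simp⟩
  · refine ⟨s.min' hne, s.max' hne + 1, ?_⟩
    ext j
    rw [mem_Ico, Nat.lt_succ_iff]
    exact ⟨fun hj => ⟨s.min'_le j hj, s.le_max' j hj⟩,
      fun hj => hs _ (s.min'_mem hne) _ (s.max'_mem hne) j hj.1 hj.2⟩

/-- Points at which a `lam`-separated sequence lies in an interval of length `δ`. -/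
lemma card_filter_Ico_le (g : ℕ → ℝ) (a b : ℕ) {lam δ y : ℝ} (hlam : 0 < lam) (hδ : 0 ≤ δ)
    (hsep : ∀ m n, a ≤ m → m ≤ n → n < b → lam * ((n : ℝ) - m) ≤ g n - g m)
    (s : Finset ℕ) (hs : s ⊆ Ico a b) (hg : ∀ m ∈ s, y ≤ g m ∧ g m ≤ y + δ) :
    (s.card : ℝ) ≤ δ / lam + 1 := by
  rcases s.eq_empty_or_nonempty with rfl | hne
  · simp only [card_empty, Nat.cast_zero]
    positivity
  · set i := s.min' hne
    set k := s.max' hne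
    have hi : i ∈ s := s.min'_mem hne
    have hk : k ∈ s := s.max'_mem hne
    have hik : i ≤ k := s.min'_le k hk
    have h1 : s ⊆ Icc i k := fun j hj => mem_Icc.2 ⟨s.min'_le j hj, s.le_max' j hj⟩
    have h2 : (s.card : ℝ) ≤ (k : ℝ) - i + 1 := by
      have := card_le_card h1
      rw [Nat.card_Icc] at this
      have h3 : s.card + i ≤ k + 1 := by omega
      have h4 : (s.card : ℝ) + i ≤ k + 1 := by exact_mod_cast h3
      linarith
    have h3 := hsep i k (mem_Ico.1 (hs hi)).1 hik (mem_Ico.1 (hs hk)).2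
    have h4 : (k : ℝ) - i ≤ δ / lam := by
      rw [le_div_iff₀ hlam]
      linarith [(hg i hi).1, (hg k hk).2]
    linarith

/-- **van der Corput's second derivative test**, with a free parameter `δ`. -/
lemma norm_sum_Ico_expTwoPi_le_of_sep (θ : ℕ → ℝ) (a b : ℕ) {lam δ A R : ℝ} (hlam : 0 < lam)
    (hδ : 0 < δ) (hR : 0 ≤ R)
    (hsep : ∀ m, a ≤ m → m + 1 < b →
      lam ≤ (θ (m + 2) - θ (m + 1)) - (θ (m + 1) - θ m))
    (hrange : ∀ m, a ≤ m → m < b → A ≤ θ (m + 1) - θ m ∧ θ (m + 1) - θ m ≤ A + R) :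
    ‖∑ m ∈ Ico a b, expTwoPi (θ m)‖ ≤ (R + 2) * (2 * (δ / lam + 1) + 2 / δ) := by
  set g : ℕ → ℝ := fun m => θ (m + 1) - θ m with hg
  have hsep' : ∀ m n, a ≤ m → m ≤ n → n < b → lam * ((n : ℝ) - m) ≤ g n - g m := by
    intro m n ham hmn
    induction n, hmn using Nat.le_induction with
    | base => intro _; simp
    | succ n hn ih =>
      intro hb
      have h1 := ih (by omega)
      have h2 := hsep n (by omega) hb
      simp only [hg] at h1 ⊢
      push_cast
      linarith
  have hmono : ∀ m n, a ≤ m → m ≤ n → n < b → g m ≤ g n := fun m n h1 h2 h3 => by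
    have := hsep' m n h1 h2 h3
    have h4 : (m : ℝ) ≤ n := by exact_mod_cast h2
    nlinarith
  have hfib : ∀ ν : ℤ, ‖∑ m ∈ Ico a b with ⌊g m⌋ = ν, expTwoPi (θ m)‖ ≤
      2 * (δ / lam + 1) + 2 / δ := by
    intro ν
    set F := (Ico a b).filter (fun m => ⌊g m⌋ = ν) with hF
    have hFm : ∀ m ∈ F, (a ≤ m ∧ m < b) ∧ (ν : ℝ) ≤ g m ∧ g m < ν + 1 := fun m hm => by
      obtain ⟨h1, h2⟩ := mem_filter.1 hm
      exact ⟨mem_Ico.1 h1, Int.floor_eq_iff.1 h2⟩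
    have htriv : ∀ s : Finset ℕ, ‖∑ m ∈ s, expTwoPi (θ m)‖ ≤ s.card := fun s => by
      refine (norm_sum_le _ _).trans ?_
      simp [norm_expTwoPi]
    rw [← sum_filter_add_sum_filter_not F (fun m => g m < ν + δ),
      ← sum_filter_add_sum_filter_not (F.filter (fun m => ¬ g m < ν + δ))
        (fun m => ν + 1 - δ < g m)]
    have hlow : ‖∑ m ∈ F with g m < ν + δ, expTwoPi (θ m)‖ ≤ δ / lam + 1 := by
      refine (htriv _).trans (card_filter_Ico_le g a b hlam hδ.le hsep' _
        ((filter_subset _ _).trans (filter_subset _ _)) (y := ν) fun m hm => ?_)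
      obtain ⟨h1, h2⟩ := mem_filter.1 hm
      exact ⟨(hFm m h1).2.1, h2.le⟩
    have hhigh : ‖∑ m ∈ (F.filter (fun m => ¬ g m < ν + δ)) with ν + 1 - δ < g m,
        expTwoPi (θ m)‖ ≤ δ / lam + 1 := by
      refine (htriv _).trans (card_filter_Ico_le g a b hlam hδ.le hsep' _
        ((filter_subset _ _).trans ((filter_subset _ _).trans (filter_subset _ _)))
        (y := ν + 1 - δ) fun m hm => ?_)
      obtain ⟨h1, h2⟩ := mem_filter.1 hm
      have h3 := (hFm m (mem_filter.1 h1).1).2.2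
      exact ⟨h2.le, by linarith⟩
    have hmid : ‖∑ m ∈ (F.filter (fun m => ¬ g m < ν + δ)) with ¬ (ν + 1 - δ < g m),
        expTwoPi (θ m)‖ ≤ 2 / δ := by
      set G := (F.filter (fun m => ¬ g m < ν + δ)).filter (fun m => ¬ (ν + 1 - δ < g m)) with hG
      have hGm : ∀ m, m ∈ G ↔ (a ≤ m ∧ m < b) ∧ (ν : ℝ) + δ ≤ g m ∧ g m ≤ ν + 1 - δ := by
        intro m
        rw [hG, mem_filter, mem_filter, hF, mem_filter, mem_Ico, Int.floor_eq_iff, not_lt, not_lt]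
        constructor
        · rintro ⟨⟨⟨h1, _⟩, h2⟩, h3⟩
          exact ⟨h1, h2, h3⟩
        · rintro ⟨h1, h2, h3⟩
          exact ⟨⟨⟨h1, by linarith, by linarith⟩, h2⟩, h3⟩
      obtain ⟨p, q, hpq⟩ := exists_eq_Ico_of_ordConnected G (fun i hi k hk j hij hjk => by
        rw [hGm] at hi hk ⊢
        refine ⟨⟨hi.1.1.trans hij, hjk.trans_lt hk.1.2⟩, ?_, ?_⟩
        · exact hi.2.1.trans (hmono i j hi.1.1 hij (hjk.trans_lt hk.1.2))
        · exact (hmono j k (hi.1.1.trans hij) hjk hk.1.2).trans hk.2.2)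
      have hmem : ∀ m, p ≤ m → m < q → (a ≤ m ∧ m < b) ∧ (ν : ℝ) + δ ≤ g m ∧ g m ≤ ν + 1 - δ :=
        fun m h1 h2 => (hGm m).1 (hpq ▸ mem_Ico.2 ⟨h1, h2⟩)
      rw [hpq]
      refine norm_sum_Ico_expTwoPi_le θ p q ν hδ (fun m h1 h2 => ?_)
        (fun m h1 h2 => (hmem m h1 h2).2.1) (fun m h1 h2 => (hmem m h1 h2).2.2)
      have h3 := (hmem m h1 (by omega)).1.1
      have h4 := (hmem (m + 1) (by omega) h2).1.2
      exact hmono m (m + 1) h3 (by omega) h4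
    have h1 := norm_add_le
      (∑ m ∈ (F.filter (fun m => ¬ g m < ν + δ)) with ν + 1 - δ < g m, expTwoPi (θ m))
      (∑ m ∈ (F.filter (fun m => ¬ g m < ν + δ)) with ¬ (ν + 1 - δ < g m), expTwoPi (θ m))
    refine (norm_add_le _ _).trans ?_
    linarith
  have hmaps : ∀ m ∈ Ico a b, ⌊g m⌋ ∈ Icc ⌊A⌋ ⌊A + R⌋ := fun m hm => by
    have h := hrange m (mem_Ico.1 hm).1 (mem_Ico.1 hm).2
    exact mem_Icc.2 ⟨Int.floor_le_floor h.1, Int.floor_le_floor h.2⟩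
  rw [← sum_fiberwise_of_maps_to hmaps]
  refine (norm_sum_le _ _).trans ((sum_le_card_nsmul _ _ _ (fun ν _ => hfib ν)).trans ?_)
  rw [nsmul_eq_mul]
  gcongr
  rw [Int.card_Icc]
  have h1 : ⌊A⌋ ≤ ⌊A + R⌋ := Int.floor_le_floor (by linarith)
  have h2 : (((⌊A + R⌋ + 1 - ⌊A⌋).toNat : ℤ) : ℝ) = ((⌊A + R⌋ + 1 - ⌊A⌋ : ℤ) : ℝ) := by
    rw [Int.toNat_of_nonneg (by omega)]
  rw [Int.cast_natCast] at h2
  rw [h2]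
  push_cast
  linarith [Int.floor_le (A + R), Int.lt_floor_add_one A]

/-- The exponential sum of `e(β m ^ c)` over `X ≤ m < 16 X`. -/
noncomputable def powSum (c : ℝ) (X : ℕ) (β : ℝ) : ℂ :=
  ∑ m ∈ Ico X (16 * X), expTwoPi (β * (m : ℝ) ^ c)

/-- The integral analogue of `powSum`. -/
noncomputable def powInt (c : ℝ) (X : ℕ) (β : ℝ) : ℂ :=
  ∫ u in (X : ℝ)..(16 * X : ℕ), expTwoPi (β * u ^ c)

lemma exists_rpow_sub_rpow_eq (p : ℝ) {u v : ℝ} (hu : 0 < u) (huv : u < v) :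
    ∃ ξ, u < ξ ∧ ξ < v ∧ v ^ p - u ^ p = p * ξ ^ (p - 1) * (v - u) := by
  obtain ⟨ξ, hξ, h⟩ := exists_hasDerivAt_eq_slope (fun t : ℝ => t ^ p) (fun t => p * t ^ (p - 1)) huv
    (fun t ht => (continuousAt_rpow_const t p (Or.inl (hu.trans_le ht.1).ne')).continuousWithinAt)
    (fun t ht => hasDerivAt_rpow_const (Or.inl (hu.trans ht.1).ne'))
  refine ⟨ξ, hξ.1, hξ.2, ?_⟩
  rw [h, div_mul_cancel₀]
  linarith

lemma le_second_difference_rpow {c u : ℝ} (hc1 : 1 < c) (hc2 : c < 2) (hu : 0 < u) :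
    c * (c - 1) * (u + 2) ^ (c - 2) ≤ ((u + 2) ^ c - (u + 1) ^ c) - ((u + 1) ^ c - u ^ c) := by
  obtain ⟨ξ, hξ, h⟩ := exists_hasDerivAt_eq_slope (fun t : ℝ => (t + 1) ^ c - t ^ c)
    (fun t => c * (t + 1) ^ (c - 1) - c * t ^ (c - 1)) (show u < u + 1 by linarith)
    (fun t ht => by
      have h1 : t ≠ 0 := (hu.trans_le ht.1).ne'
      have h2 : t + 1 ≠ 0 := by linarith [hu.trans_le ht.1]
      exact (((continuousAt_id.add continuousAt_const).rpow_const (Or.inl h2)).sub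
        (continuousAt_id.rpow_const (Or.inl h1))).continuousWithinAt)
    (fun t ht => by
      have h1 : t ≠ 0 := (hu.trans ht.1).ne'
      have h2 : t + 1 ≠ 0 := by linarith [hu.trans ht.1]
      have h3 := ((hasDerivAt_id t).add_const 1).rpow_const (p := c) (Or.inl h2)
      have h4 := hasDerivAt_rpow_const (x := t) (p := c) (Or.inl h1)
      exact (h3.sub h4).congr_deriv (by simp))
  have hξ0 : 0 < ξ := hu.trans hξ.1
  obtain ⟨η, hη1, hη2, h5⟩ := exists_rpow_sub_rpow_eq (c - 1) hξ0 (show ξ < ξ + 1 by linarith)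
  have h6 : (u + 2) ^ (c - 2) ≤ η ^ (c - 1 - 1) := by
    rw [show c - 1 - 1 = c - 2 by ring]
    exact rpow_le_rpow_of_nonpos (by linarith) (by linarith [hξ.2]) (by linarith)
  have h7 : ((u + 2) ^ c - (u + 1) ^ c) - ((u + 1) ^ c - u ^ c) =
      c * ((c - 1) * η ^ (c - 1 - 1)) := by
    have h8 : c * ((ξ + 1) ^ (c - 1) - ξ ^ (c - 1)) = c * ((c - 1) * η ^ (c - 1 - 1)) := by
      rw [h5]; ring
    rw [← h8, mul_sub, h]
    ring_nf
  rw [h7, mul_assoc]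
  have : 0 ≤ c - 1 := by linarith
  gcongr

lemma continuous_expTwoPi_mul_rpow {c : ℝ} (hc : 0 ≤ c) (β : ℝ) :
    Continuous fun u : ℝ => expTwoPi (β * u ^ c) :=
  continuous_expTwoPi.comp (continuous_const.mul (continuous_rpow_const hc))

lemma norm_powSum_sub_powInt_le {c : ℝ} (hc : 0 ≤ c) (X : ℕ) {β : ℝ} (hβ : 0 ≤ β) :
    ‖powSum c X β - powInt c X β‖ ≤ 2 * π * β * (16 * X : ℝ) ^ c := by
  have hcont := continuous_expTwoPi_mul_rpow hc β
  have hinteg : ∀ a b : ℝ, IntervalIntegrable (fun u : ℝ => expTwoPi (β * u ^ c)) volume a b :=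
    fun a b => hcont.intervalIntegrable a b
  have hI : powInt c X β =
      ∑ m ∈ Ico X (16 * X), ∫ u in (m : ℝ)..((m + 1 : ℕ) : ℝ), expTwoPi (β * u ^ c) := by
    rw [powInt, intervalIntegral.sum_integral_adjacent_intervals_Ico (a := fun m : ℕ => (m : ℝ))
      (by omega) (fun k _ => hinteg _ _)]
  have hterm : ∀ m ∈ Ico X (16 * X),
      ‖expTwoPi (β * (m : ℝ) ^ c) - ∫ u in (m : ℝ)..((m + 1 : ℕ) : ℝ), expTwoPi (β * u ^ c)‖ ≤
        2 * π * β * (((m + 1 : ℕ) : ℝ) ^ c - (m : ℝ) ^ c) := by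
    intro m _
    have h1 : expTwoPi (β * (m : ℝ) ^ c) =
        ∫ _ in (m : ℝ)..((m + 1 : ℕ) : ℝ), expTwoPi (β * (m : ℝ) ^ c) := by
      rw [intervalIntegral.integral_const]
      simp
    rw [h1, ← intervalIntegral.integral_sub (by simp) (hinteg _ _)]
    have h2 := intervalIntegral.norm_integral_le_of_norm_le_const (a := (m : ℝ))
      (b := ((m + 1 : ℕ) : ℝ)) (f := fun u => expTwoPi (β * (m : ℝ) ^ c) - expTwoPi (β * u ^ c))
      (C := 2 * π * β * (((m + 1 : ℕ) : ℝ) ^ c - (m : ℝ) ^ c)) (fun u hu => by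
        rw [Set.uIoc_of_le (by simp)] at hu
        refine (norm_expTwoPi_sub_le _ _).trans ?_
        have hm0 : (0 : ℝ) ≤ m := m.cast_nonneg
        have h3 : (m : ℝ) ^ c ≤ u ^ c := rpow_le_rpow hm0 hu.1.le hc
        have h4 : u ^ c ≤ ((m + 1 : ℕ) : ℝ) ^ c := rpow_le_rpow (hm0.trans hu.1.le) hu.2 hc
        rw [← mul_sub, abs_mul, abs_of_nonneg hβ, abs_sub_comm, abs_of_nonneg (by linarith),
          mul_assoc (2 * π)]
        gcongr)
    simpa using h2
  rw [powSum, hI, ← sum_sub_distrib]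
  refine (norm_sum_le _ _).trans ((sum_le_sum hterm).trans ?_)
  rw [← mul_sum, sum_Ico_sub (fun m : ℕ => (m : ℝ) ^ c) (by omega)]
  have : (0 : ℝ) ≤ (X : ℝ) ^ c := by positivity
  push_cast
  gcongr
  linarith

lemma norm_powInt_le {c : ℝ} (hc1 : 1 < c) (hc2 : c < 3 / 2) {X : ℕ} (hX : 0 < X) {β : ℝ}
    (hβ : 0 < β) : ‖powInt c X β‖ ≤ 17 / (β * (X : ℝ) ^ (c - 1)) := by
  have hX0 : (0 : ℝ) < X := by exact_mod_cast hX
  have hle : (X : ℝ) ≤ ((16 * X : ℕ) : ℝ) := by push_cast; linarith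
  set K : ℂ := 2 * π * Complex.I * β * c with hK
  have hKn : ‖K‖ = 2 * π * β * c := by
    simp [hK, abs_of_pos pi_pos, abs_of_pos hβ, abs_of_pos (by linarith : 0 < c)]
  have hK1 : β ≤ ‖K‖ := by
    rw [hKn]
    have h1 : 1 ≤ 2 * π * c := by nlinarith [pi_gt_three]
    nlinarith
  have hK0 : K ≠ 0 := by
    rw [← norm_pos_iff]
    linarith
  have hpos : ∀ u ∈ Set.uIcc (X : ℝ) ((16 * X : ℕ) : ℝ), (X : ℝ) ≤ u := fun u hu => by
    rw [Set.uIcc_of_le hle] at hu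
    exact hu.1
  have hF : ∀ u ∈ Set.uIcc (X : ℝ) ((16 * X : ℕ) : ℝ),
      HasDerivAt (fun u : ℝ => expTwoPi (β * u ^ c))
        (K * ((u ^ (c - 1) : ℝ) : ℂ) * expTwoPi (β * u ^ c)) u := fun u hu => by
    have hu0 : u ≠ 0 := (hX0.trans_le (hpos u hu)).ne'
    have h1 : HasDerivAt (fun u : ℝ => β * u ^ c) (β * (c * u ^ (c - 1))) u :=
      (hasDerivAt_rpow_const (Or.inl hu0)).const_mul β
    have h2 := (hasDerivAt_expTwoPi (β * u ^ c)).scomp u h1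
    refine h2.congr_deriv ?_
    rw [Complex.real_smul, hK]
    push_cast
    ring
  have hG : ∀ u ∈ Set.uIcc (X : ℝ) ((16 * X : ℕ) : ℝ),
      HasDerivAt (fun u : ℝ => ((u ^ (1 - c) : ℝ) : ℂ) / K)
        ((((1 - c) * u ^ (1 - c - 1) : ℝ) : ℂ) / K) u := fun u hu => by
    have hu0 : u ≠ 0 := (hX0.trans_le (hpos u hu)).ne'
    exact ((hasDerivAt_rpow_const (Or.inl hu0)).ofReal_comp).div_const K
  have hcr : ∀ p : ℝ, ContinuousOn (fun u : ℝ => ((u ^ p : ℝ) : ℂ))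
      (Set.uIcc (X : ℝ) ((16 * X : ℕ) : ℝ)) := fun p =>
    Complex.continuous_ofReal.comp_continuousOn
      (continuousOn_id.rpow_const fun u hu => Or.inl (hX0.trans_le (hpos u hu)).ne')
  have hce := (continuous_expTwoPi_mul_rpow (by linarith : 0 ≤ c) β)
  have hparts := intervalIntegral.integral_mul_deriv_eq_deriv_mul hG hF
    (((continuousOn_const.mul (hcr (1 - c - 1))).div_const K).congr (fun u _ => by
      push_cast; rfl)).intervalIntegrable
    ((continuousOn_const.mul (hcr (c - 1))).mul hce.continuousOn).intervalIntegrable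
  have hL : ∫ u in (X : ℝ)..((16 * X : ℕ) : ℝ), ((u ^ (1 - c) : ℝ) : ℂ) / K *
      (K * ((u ^ (c - 1) : ℝ) : ℂ) * expTwoPi (β * u ^ c)) = powInt c X β := by
    refine intervalIntegral.integral_congr fun u hu => ?_
    have hu0 : 0 < u := hX0.trans_le (hpos u hu)
    have h1 : ((u ^ (1 - c) : ℝ) : ℂ) * ((u ^ (c - 1) : ℝ) : ℂ) = 1 := by
      rw [← Complex.ofReal_mul, ← rpow_add hu0]
      simp
    have h2 : ((u ^ (1 - c) : ℝ) : ℂ) / K * (K * ((u ^ (c - 1) : ℝ) : ℂ) * expTwoPi (β * u ^ c)) =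
        (((u ^ (1 - c) : ℝ) : ℂ) * ((u ^ (c - 1) : ℝ) : ℂ)) * expTwoPi (β * u ^ c) := by
      field_simp
    rw [h2, h1, one_mul]
  rw [hL] at hparts
  set B : ℝ := (X : ℝ) ^ (1 - c) / β with hB
  have hB0 : 0 < B := by positivity
  have hbd : ∀ u : ℝ, (X : ℝ) ≤ u → ‖((u ^ (1 - c) : ℝ) : ℂ) / K * expTwoPi (β * u ^ c)‖ ≤ B := by
    intro u hu
    rw [norm_mul, norm_expTwoPi, mul_one, norm_div, Complex.norm_real, norm_eq_abs,
      abs_of_nonneg (rpow_nonneg (hX0.le.trans hu) _)]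
    exact div_le_div₀ (by positivity) (rpow_le_rpow_of_nonpos hX0 hu (by linarith)) hβ hK1
  have hinteg := intervalIntegral.norm_integral_le_of_norm_le_const (a := (X : ℝ))
    (b := ((16 * X : ℕ) : ℝ))
    (f := fun u => (((1 - c) * u ^ (1 - c - 1) : ℝ) : ℂ) / K * expTwoPi (β * u ^ c))
    (C := B / X) (fun u hu => by
      rw [Set.uIoc_of_le hle] at hu
      have hu0 : 0 < u := hX0.trans hu.1
      rw [norm_mul, norm_expTwoPi, mul_one, norm_div, Complex.norm_real, norm_eq_abs, abs_mul,
        abs_of_pos (rpow_pos_of_pos hu0 _), abs_of_nonpos (by linarith : 1 - c ≤ 0), hB, div_div,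
        mul_comm β, ← div_div, ← rpow_sub_one hX0.ne']
      refine div_le_div₀ (by positivity) ?_ hβ hK1
      have h1 : u ^ (1 - c - 1) ≤ (X : ℝ) ^ (1 - c - 1) :=
        rpow_le_rpow_of_nonpos hX0 hu.1.le (by linarith)
      have h2 : 0 < u ^ (1 - c - 1) := rpow_pos_of_pos hu0 _
      nlinarith)
  have hlen : B / X * |((16 * X : ℕ) : ℝ) - X| = 15 * B := by
    push_cast
    rw [show (16 * (X : ℝ) - X) = 15 * X by ring, abs_of_pos (by positivity)]
    field_simp
  rw [hlen] at hinteg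
  have hfin : 17 / (β * (X : ℝ) ^ (c - 1)) = 17 * B := by
    rw [hB, show 1 - c = -(c - 1) by ring, rpow_neg hX0.le]
    field_simp
  rw [hfin, hparts]
  refine (norm_sub_le _ _).trans ((add_le_add (norm_sub_le _ _) le_rfl).trans ?_)
  linarith [hbd _ hle, hbd _ le_rfl]

lemma norm_powSum_le {c : ℝ} (hc1 : 1 < c) (hc2 : c < 3 / 2) {X : ℕ} (hX : 0 < X) {β : ℝ}
    (hβ : 0 < β) (hβX : (X : ℝ) ^ (-(c / 2)) ≤ β) :
    ‖powSum c X β‖ ≤ (1000 / (c - 1)) * (1 + β) * (X : ℝ) ^ (c / 2) := by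
  have hX0 : (0 : ℝ) < X := by exact_mod_cast hX
  have hX1 : (1 : ℝ) ≤ X := by exact_mod_cast hX
  have hk : 2 ≤ 1 / (c - 1) := by
    rw [le_div_iff₀ (by linarith)]
    linarith
  set D : ℝ := β * (X : ℝ) ^ (c - 1) with hD
  have hD0 : 0 < D := by positivity
  have hW0 : 0 < (X : ℝ) ^ (c / 2) := by positivity
  have h16 : (16 : ℝ) ^ (c - 1) ≤ 4 := by
    calc (16 : ℝ) ^ (c - 1) ≤ 16 ^ (1 / 2 : ℝ) :=
          rpow_le_rpow_of_exponent_le (by norm_num) (by linarith)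
      _ = 4 := by
        rw [show (16 : ℝ) = 4 ^ (2 : ℝ) by norm_num, ← rpow_mul (by norm_num)]
        norm_num
  have hdiff : ∀ m : ℕ, X ≤ m → m < 16 * X →
      D ≤ β * ((m + 1 : ℕ) : ℝ) ^ c - β * (m : ℝ) ^ c ∧
        β * ((m + 1 : ℕ) : ℝ) ^ c - β * (m : ℝ) ^ c ≤ 6 * D := by
    intro m h1 h2
    have h1' : (X : ℝ) ≤ m := by exact_mod_cast h1
    have h2' : ((m : ℝ) + 1) ≤ 16 * X := by exact_mod_cast h2
    obtain ⟨ξ, hξ1, hξ2, h⟩ := exists_rpow_sub_rpow_eq c (hX0.trans_le h1')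
      (show (m : ℝ) < m + 1 by linarith)
    have h3 : (X : ℝ) ^ (c - 1) ≤ ξ ^ (c - 1) :=
      rpow_le_rpow hX0.le (by linarith) (by linarith)
    have h4 : ξ ^ (c - 1) ≤ 4 * (X : ℝ) ^ (c - 1) := by
      calc ξ ^ (c - 1) ≤ (16 * X : ℝ) ^ (c - 1) :=
            rpow_le_rpow (by linarith) (by linarith) (by linarith)
        _ = 16 ^ (c - 1) * (X : ℝ) ^ (c - 1) := mul_rpow (by norm_num) hX0.le
        _ ≤ 4 * (X : ℝ) ^ (c - 1) := by gcongr
    have h5 : 0 < (X : ℝ) ^ (c - 1) := by positivity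
    push_cast
    rw [← mul_sub, h, hD, show (m : ℝ) + 1 - m = 1 by ring, mul_one]
    constructor
    · gcongr
      nlinarith
    · rw [show 6 * (β * (X : ℝ) ^ (c - 1)) = β * (6 * (X : ℝ) ^ (c - 1)) by ring]
      refine mul_le_mul_of_nonneg_left ?_ hβ.le
      nlinarith
  have hsecond : ∀ m : ℕ, X ≤ m → m + 1 < 16 * X →
      β * (c - 1) * (X : ℝ) ^ (c - 2) / 16 ≤
        (β * ((m + 2 : ℕ) : ℝ) ^ c - β * ((m + 1 : ℕ) : ℝ) ^ c) -
          (β * ((m + 1 : ℕ) : ℝ) ^ c - β * (m : ℝ) ^ c) := by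
    intro m h1 h2
    have h1' : (X : ℝ) ≤ m := by exact_mod_cast h1
    have h2' : ((m : ℝ) + 2) ≤ 16 * X := by
      have : m + 2 ≤ 16 * X := by omega
      exact_mod_cast this
    have h3 := le_second_difference_rpow hc1 (by linarith) (hX0.trans_le h1')
    have h4 : (X : ℝ) ^ (c - 2) / 16 ≤ ((m : ℝ) + 2) ^ (c - 2) := by
      calc (X : ℝ) ^ (c - 2) / 16 = 16 ^ (-1 : ℝ) * (X : ℝ) ^ (c - 2) := by
            rw [rpow_neg_one]; ring
        _ ≤ 16 ^ (c - 2) * (X : ℝ) ^ (c - 2) := by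
            gcongr
            · norm_num
            · linarith
        _ = (16 * X : ℝ) ^ (c - 2) := (mul_rpow (by norm_num) hX0.le).symm
        _ ≤ ((m : ℝ) + 2) ^ (c - 2) :=
            rpow_le_rpow_of_nonpos (by linarith) h2' (by linarith)
    push_cast
    have h5 : (c - 1) * ((X : ℝ) ^ (c - 2) / 16) ≤ c * (c - 1) * ((m : ℝ) + 2) ^ (c - 2) := by
      have h6 : 0 < (X : ℝ) ^ (c - 2) / 16 := by positivity
      have h7 : (c - 1) ≤ c * (c - 1) := by nlinarith
      have h8 : 0 ≤ c - 1 := by linarith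
      gcongr
    have h9 := mul_le_mul_of_nonneg_left (h5.trans h3) hβ.le
    linarith
  have hmono : ∀ m : ℕ, X ≤ m → m + 1 < 16 * X →
      β * ((m + 1 : ℕ) : ℝ) ^ c - β * (m : ℝ) ^ c ≤
        β * ((m + 2 : ℕ) : ℝ) ^ c - β * ((m + 1 : ℕ) : ℝ) ^ c := fun m h1 h2 => by
    have h3 := hsecond m h1 h2
    have h4 : 0 ≤ β * (c - 1) * (X : ℝ) ^ (c - 2) / 16 := by
      have : 0 ≤ c - 1 := by linarith
      positivity
    linarith
  rcases le_or_gt (6 * D) (1 / 2) with hsmall | hlarge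
  · have h1 := norm_sum_Ico_expTwoPi_le (fun m : ℕ => β * (m : ℝ) ^ c) X (16 * X) 0 hD0 hmono
      (fun m h1 h2 => by simpa using (hdiff m h1 h2).1)
      (fun m h1 h2 => by
        have := (hdiff m h1 h2).2
        push_cast at this ⊢
        linarith)
    have h2 : 2 / D ≤ 2 * (X : ℝ) ^ (c / 2) := by
      rw [div_le_iff₀ hD0, hD]
      have h3 : (1 : ℝ) ≤ β * (X : ℝ) ^ (c / 2) * (X : ℝ) ^ (c - 1) := by
        calc (1 : ℝ) ≤ (X : ℝ) ^ (-(c / 2)) * (X : ℝ) ^ (c / 2) * (X : ℝ) ^ (c - 1) := by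
              rw [← rpow_add hX0, neg_add_cancel, rpow_zero, one_mul]
              exact one_le_rpow hX1 (by linarith)
          _ ≤ _ := by gcongr
      linarith
    refine h1.trans (h2.trans ?_)
    have h3 : 2 ≤ 1000 / (c - 1) * (1 + β) := by
      rw [show 1000 / (c - 1) = 1000 * (1 / (c - 1)) by ring]
      nlinarith
    gcongr
  · set δ : ℝ := (X : ℝ) ^ (c / 2 - 1) with hδ
    set lam : ℝ := β * (c - 1) * (X : ℝ) ^ (c - 2) / 16 with hlam
    have hc0 : 0 < c - 1 := by linarith
    have hδ0 : 0 < δ := by positivity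
    have h1 := norm_sum_Ico_expTwoPi_le_of_sep (fun m : ℕ => β * (m : ℝ) ^ c) X (16 * X)
      (lam := lam) (δ := δ) (A := D) (R := 5 * D) (by positivity) (by positivity) (by positivity)
      hsecond (fun m h1 h2 => ⟨(hdiff m h1 h2).1, by linarith [(hdiff m h1 h2).2]⟩)
    refine h1.trans ?_
    have e1 : D * (δ / lam) = 16 * (1 / (c - 1)) * (X : ℝ) ^ (c / 2) := by
      have : (X : ℝ) ^ (c - 1) * δ = (X : ℝ) ^ (c / 2) * (X : ℝ) ^ (c - 2) := by
        rw [hδ, ← rpow_add hX0, ← rpow_add hX0]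
        ring_nf
      rw [hD, hlam]
      field_simp
      linear_combination this
    have e2 : D * (1 / δ) = β * (X : ℝ) ^ (c / 2) := by
      have : (X : ℝ) ^ (c - 1) = (X : ℝ) ^ (c / 2) * δ := by
        rw [hδ, ← rpow_add hX0]
        ring_nf
      rw [hD]
      field_simp
      linear_combination this
    have e3 : D ≤ β * (X : ℝ) ^ (c / 2) := by
      rw [hD]
      gcongr
      linarith
    have h2 : 5 * D + 2 ≤ 29 * D := by linarith
    calc (5 * D + 2) * (2 * (δ / lam + 1) + 2 / δ)
        ≤ 29 * D * (2 * (δ / lam + 1) + 2 / δ) := by gcongr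
      _ = 58 * (D * (δ / lam)) + 58 * D + 58 * (D * (1 / δ)) := by ring
      _ ≤ 58 * (16 * (1 / (c - 1)) * (X : ℝ) ^ (c / 2)) + 116 * (β * (X : ℝ) ^ (c / 2)) := by
        rw [e1, e2]
        linarith
      _ = (928 * (1 / (c - 1)) + 116 * β) * (X : ℝ) ^ (c / 2) := by ring
      _ ≤ _ := by
        gcongr
        rw [show 1000 / (c - 1) = 1000 * (1 / (c - 1)) by ring]
        nlinarith

/-- Sum minus integral is `O((1 + |β|) X ^ (c / 2))`, uniformly in the frequency. -/
lemma exists_norm_powSum_sub_powInt_le {c : ℝ} (hc1 : 1 < c) (hc2 : c < 3 / 2) :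
    ∃ C : ℝ, 0 < C ∧ ∀ X : ℕ, 0 < X → ∀ β : ℝ,
      ‖powSum c X β - powInt c X β‖ ≤ C * (1 + |β|) * (X : ℝ) ^ (c / 2) := by
  have hc0 : 0 < c - 1 := by linarith
  refine ⟨1000 / (c - 1) + 512, by positivity, ?_⟩
  have main : ∀ X : ℕ, 0 < X → ∀ β : ℝ, 0 ≤ β →
      ‖powSum c X β - powInt c X β‖ ≤ (1000 / (c - 1) + 512) * (1 + β) * (X : ℝ) ^ (c / 2) := by
    intro X hX β hβ
    have hX0 : (0 : ℝ) < X := by exact_mod_cast hX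
    have hX1 : (1 : ℝ) ≤ X := by exact_mod_cast hX
    have hW0 : 0 < (X : ℝ) ^ (c / 2) := by positivity
    have hk0 : 0 < 1000 / (c - 1) := by positivity
    rcases le_or_gt β ((X : ℝ) ^ (-(c / 2))) with h | h
    · refine (norm_powSum_sub_powInt_le (by linarith) X hβ).trans ?_
      have h16 : (16 : ℝ) ^ c ≤ 64 := by
        calc (16 : ℝ) ^ c ≤ 16 ^ (3 / 2 : ℝ) :=
              rpow_le_rpow_of_exponent_le (by norm_num) (by linarith)
          _ = 64 := by
            rw [show (16 : ℝ) = 4 ^ (2 : ℝ) by norm_num, ← rpow_mul (by norm_num)]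
            norm_num
      calc 2 * π * β * (16 * X : ℝ) ^ c
          ≤ 2 * 4 * (X : ℝ) ^ (-(c / 2)) * (64 * (X : ℝ) ^ c) := by
            rw [mul_rpow (by norm_num) hX0.le]
            gcongr
            exact pi_le_four
        _ = 512 * (X : ℝ) ^ (c / 2) := by
            rw [show 2 * 4 * (X : ℝ) ^ (-(c / 2)) * (64 * (X : ℝ) ^ c) =
              512 * ((X : ℝ) ^ (-(c / 2)) * (X : ℝ) ^ c) by ring, ← rpow_add hX0]
            ring_nf
        _ ≤ _ := by
            gcongr
            nlinarith
    · have hβ0 : 0 < β := lt_of_le_of_lt (by positivity) h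
      have h1 := norm_powSum_le hc1 hc2 hX hβ0 h.le
      have h2 := norm_powInt_le hc1 hc2 hX hβ0
      have h3 : 17 / (β * (X : ℝ) ^ (c - 1)) ≤ 17 * (X : ℝ) ^ (c / 2) := by
        rw [div_le_iff₀ (by positivity)]
        have h3 : (1 : ℝ) ≤ β * (X : ℝ) ^ (c / 2) * (X : ℝ) ^ (c - 1) := by
          calc (1 : ℝ) ≤ (X : ℝ) ^ (-(c / 2)) * (X : ℝ) ^ (c / 2) * (X : ℝ) ^ (c - 1) := by
                rw [← rpow_add hX0, neg_add_cancel, rpow_zero, one_mul]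
                exact one_le_rpow hX1 (by linarith)
            _ ≤ _ := by gcongr
        linarith
      refine (norm_sub_le _ _).trans ?_
      nlinarith [mul_pos hβ0 hW0]
  intro X hX β
  rcases le_total 0 β with h | h
  · rw [abs_of_nonneg h]
    exact main X hX β h
  · rw [abs_of_nonpos h]
    refine le_trans (le_of_eq ?_) (main X hX (-β) (by linarith))
    have h1 : powSum c X (-β) = (starRingEnd ℂ) (powSum c X β) := by
      rw [powSum, powSum, map_sum]
      exact sum_congr rfl fun m _ => by rw [neg_mul, expTwoPi_neg]
    have h2 : powInt c X (-β) = (starRingEnd ℂ) (powInt c X β) := by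
      have hle : (X : ℝ) ≤ ((16 * X : ℕ) : ℝ) := by exact_mod_cast (by omega : X ≤ 16 * X)
      rw [powInt, powInt, intervalIntegral.integral_of_le hle, intervalIntegral.integral_of_le hle,
        ← integral_conj]
      exact integral_congr_ae (Filter.Eventually.of_forall fun u => by
        simp only [neg_mul, expTwoPi_neg])
    rw [h1, h2, ← map_sub, RCLike.norm_conj]

/-- A smooth bump inside the unit interval together with its Fourier inversion formula. -/
lemma exists_bump : ∃ (φ : ℝ → ℝ) (Φ : ℝ → ℂ) (C : ℝ), 0 < C ∧ Continuous φ ∧ (∀ t, 0 ≤ φ t) ∧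
    (∀ t, φ t ≠ 0 → 0 ≤ t ∧ t < 1) ∧ (∀ t, |t - 1 / 2| ≤ 1 / 8 → φ t = 1) ∧ Continuous Φ ∧
    Integrable Φ ∧ (∀ β, (1 + |β|) * ‖Φ β‖ ≤ C * (1 + β ^ 2)⁻¹) ∧
    ∀ t, (φ t : ℂ) = ∫ β, Φ β * expTwoPi (β * t) := by
  let b : ContDiffBump (1 / 2 : ℝ) := ⟨1 / 8, 1 / 4, by norm_num, by norm_num⟩
  have hsupp : HasCompactSupport (fun t : ℝ => (b t : ℂ)) :=
    b.hasCompactSupport.comp_left Complex.ofReal_zero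
  have hsmooth : ContDiff ℝ ((⊤ : ℕ∞) : WithTop ℕ∞) (fun t : ℝ => (b t : ℂ)) :=
    Complex.ofRealCLM.contDiff.comp b.contDiff
  let f : SchwartzMap ℝ ℂ := hsupp.toSchwartzMap hsmooth
  let Ψ : SchwartzMap ℝ ℂ := FourierTransform.fourier f
  have hdecay : ∃ C : ℝ, ∀ β : ℝ, (1 + |β|) ^ 3 * ‖Ψ β‖ ≤ C := by
    have h := SchwartzMap.one_add_le_sup_seminorm_apply (𝕜 := ℂ) (m := (3, 0)) (k := 3) (n := 0)
      le_rfl le_rfl Ψ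
    simp only [norm_iteratedFDeriv_zero, norm_eq_abs] at h
    exact ⟨_, h⟩
  obtain ⟨C, hC⟩ := hdecay
  refine ⟨b, Ψ, |C| + 1, by positivity, b.continuous, fun t => b.nonneg, fun t ht => ?_,
    fun t ht => ?_, Ψ.continuous, Ψ.integrable, fun β => ?_, fun t => ?_⟩
  · have h1 : t ∈ Metric.ball (1 / 2 : ℝ) (1 / 4) := by
      have : t ∈ Function.support b := ht
      rwa [b.support_eq] at this
    rw [Metric.mem_ball, dist_eq, abs_lt] at h1
    constructor <;> linarith [h1.1, h1.2]
  · exact b.one_of_mem_closedBall (by rwa [Metric.mem_closedBall, dist_eq])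
  · rw [← div_eq_mul_inv, le_div_iff₀ (by positivity)]
    have h1 : (1 + |β|) * (1 + β ^ 2) ≤ (1 + |β|) ^ 3 := by
      rw [← sq_abs β]
      nlinarith [abs_nonneg β, sq_nonneg β, sq_nonneg |β|]
    calc (1 + |β|) * ‖Ψ β‖ * (1 + β ^ 2) = (1 + |β|) * (1 + β ^ 2) * ‖Ψ β‖ := by ring
      _ ≤ (1 + |β|) ^ 3 * ‖Ψ β‖ := by gcongr
      _ ≤ |C| + 1 := by linarith [hC β, le_abs_self C]
  · have h1 : f t = FourierTransformInv.fourierInv Ψ t := by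
      rw [FourierTransform.fourierInv_fourier_eq]
    have h2 : (b t : ℂ) = f t := rfl
    rw [h2, h1, SchwartzMap.fourierInv_coe, fourierInv_eq']
    refine integral_congr_ae (Filter.Eventually.of_forall fun β => ?_)
    simp only [expTwoPi, smul_eq_mul]
    rw [mul_comm]
    congr 2
    simp
    ring

/-- The trigonometric polynomial with frequencies in `s`. -/
noncomputable def trigSum (s : Finset ℤ) (β : ℝ) : ℂ := ∑ n ∈ s, expTwoPi (β * n)

lemma continuous_trigSum (s : Finset ℤ) : Continuous (trigSum s) :=
  continuous_finsetSum _ fun _ _ => continuous_expTwoPi.comp (continuous_id.mul continuous_const)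

lemma norm_trigSum_le (s : Finset ℤ) (β : ℝ) : ‖trigSum s β‖ ≤ s.card := by
  refine (norm_sum_le _ _).trans ?_
  simp [norm_expTwoPi]

lemma trigSum_add_intCast (s : Finset ℤ) (β : ℝ) (h : ℤ) : trigSum s (β + h) = trigSum s β := by
  refine sum_congr rfl fun n _ => ?_
  have : expTwoPi (h * n) = 1 := by
    have := expTwoPi_intCast (h * n)
    exact_mod_cast this
  rw [add_mul, expTwoPi_add, this, mul_one]

lemma integral_expTwoPi_mul_intCast (k : ℤ) :
    ∫ β in (0 : ℝ)..1, expTwoPi (β * k) = if k = 0 then 1 else 0 := by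
  split_ifs with hk
  · simp [hk, expTwoPi]
  · have hk0 : (k : ℂ) ≠ 0 := by exact_mod_cast hk
    have hK : (2 * π * Complex.I * k : ℂ) ≠ 0 := by
      have : (π : ℂ) ≠ 0 := by exact_mod_cast pi_ne_zero
      simp [this, hk0]
    have hd : ∀ β : ℝ, HasDerivAt (fun β : ℝ => expTwoPi (β * k) / (2 * π * Complex.I * k))
        (expTwoPi (β * k)) β := fun β => by
      have h1 : HasDerivAt (fun β : ℝ => β * (k : ℝ)) k β := by
        simpa using (hasDerivAt_id β).mul_const (k : ℝ)
      refine (((hasDerivAt_expTwoPi (β * k)).scomp β h1).div_const _).congr_deriv ?_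
      rw [Complex.real_smul]
      field_simp
      push_cast
      ring
    rw [intervalIntegral.integral_eq_sub_of_hasDerivAt (fun β _ => hd β)
      ((continuous_expTwoPi.comp (continuous_id.mul continuous_const)).intervalIntegrable _ _)]
    have h1 := expTwoPi_intCast k
    have h0 := expTwoPi_intCast 0
    rw [Int.cast_zero] at h0
    rw [one_mul, zero_mul, h1, h0, sub_self]

/-- **Parseval's identity** for trigonometric polynomials. -/
lemma integral_norm_trigSum_sq (s : Finset ℤ) :
    ∫ β in (0 : ℝ)..1, ‖trigSum s β‖ ^ 2 = s.card := by
  have h1 : ∀ β : ℝ, ((‖trigSum s β‖ ^ 2 : ℝ) : ℂ) =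
      ∑ n ∈ s, ∑ m ∈ s, expTwoPi (β * ((n - m : ℤ) : ℝ)) := fun β => by
    push_cast
    rw [← Complex.mul_conj', trigSum, map_sum, sum_mul_sum]
    refine sum_congr rfl fun n _ => sum_congr rfl fun m _ => ?_
    rw [← expTwoPi_neg, ← expTwoPi_add]
    ring_nf
  have hinteg : ∀ k : ℤ, IntervalIntegrable (fun β : ℝ => expTwoPi (β * k)) volume 0 1 := fun k =>
    (continuous_expTwoPi.comp (continuous_id.mul continuous_const)).intervalIntegrable _ _
  have hintegSum : ∀ n ∈ s, IntervalIntegrable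
      (fun β : ℝ => ∑ m ∈ s, expTwoPi (β * ((n - m : ℤ) : ℝ))) volume 0 1 := fun n _ =>
    (continuous_finsetSum s fun m _ => continuous_expTwoPi.comp
      (continuous_id.mul continuous_const)).intervalIntegrable _ _
  have h2 : ((∫ β in (0 : ℝ)..1, ‖trigSum s β‖ ^ 2 : ℝ) : ℂ) = s.card := by
    rw [← intervalIntegral.integral_ofReal]
    simp_rw [h1]
    rw [intervalIntegral.integral_finsetSum hintegSum]
    have h3 : ∀ n ∈ s, ∫ β in (0 : ℝ)..1, ∑ m ∈ s, expTwoPi (β * ((n - m : ℤ) : ℝ)) = 1 := by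
      intro n hn
      rw [intervalIntegral.integral_finsetSum (fun m _ => hinteg (n - m))]
      simp_rw [integral_expTwoPi_mul_intCast, sub_eq_zero]
      simp [hn]
    rw [sum_congr rfl h3]
    simp
  exact_mod_cast h2

lemma integrable_inv_one_add_sq_mul_norm_trigSum_sq (s : Finset ℤ) :
    Integrable fun β : ℝ => (1 + β ^ 2)⁻¹ * ‖trigSum s β‖ ^ 2 := by
  refine (integrable_inv_one_add_sq.mul_const ((s.card : ℝ) ^ 2)).mono'
    (by
      refine Continuous.aestronglyMeasurable (Continuous.mul ?_ ((continuous_trigSum s).norm.pow 2))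
      exact Continuous.inv₀ (by fun_prop) fun β => by positivity)
    (Filter.Eventually.of_forall fun β => ?_)
  rw [norm_eq_abs, abs_of_nonneg (by positivity)]
  gcongr
  exact norm_trigSum_le s β

lemma exists_integral_norm_trigSum_sq_le : ∃ C : ℝ, 0 < C ∧ ∀ s : Finset ℤ,
    ∫ β : ℝ, (1 + β ^ 2)⁻¹ * ‖trigSum s β‖ ^ 2 ≤ C * s.card := by
  have hsum : Summable fun h : ℤ => 3 * (1 + (h : ℝ) ^ 2)⁻¹ := by
    refine Summable.mul_left 3 (Summable.of_nonneg_of_le (fun h => by positivity) (fun h => ?_)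
      ((summable_one_div_int_pow (p := 2)).2 (by norm_num) |>.add
        (hasSum_ite_eq (0 : ℤ) (1 : ℝ)).summable))
    split_ifs with h0
    · simp [h0]
    · have : (0 : ℝ) < (h : ℝ) ^ 2 := by positivity
      rw [add_zero, one_div]
      gcongr
      linarith
  refine ⟨∑' h : ℤ, 3 * (1 + (h : ℝ) ^ 2)⁻¹ + 1, by positivity, fun s => ?_⟩
  have h1 := (integrable_inv_one_add_sq_mul_norm_trigSum_sq s).hasSum_intervalIntegral_comp_add_int
  have h2 := hsum.hasSum.mul_right (s.card : ℝ)
  refine (hasSum_le (fun h => ?_) h1 h2).trans ?_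
  · rw [← integral_norm_trigSum_sq s, ← intervalIntegral.integral_const_mul]
    refine intervalIntegral.integral_mono_on zero_le_one ?_ ?_ fun x hx => ?_
    · refine Continuous.intervalIntegrable (Continuous.mul ?_ ?_) _ _
      · exact Continuous.inv₀ (by fun_prop) fun β => by positivity
      · exact ((continuous_trigSum s).comp (continuous_id.add continuous_const)).norm.pow 2
    · exact (((continuous_trigSum s).norm.pow 2).const_mul _).intervalIntegrable _ _
    · rw [trigSum_add_intCast]
      gcongr
      rw [← div_eq_mul_inv, le_div_iff₀ (by positivity), inv_mul_le_iff₀ (by positivity)]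
      nlinarith [hx.1, hx.2, sq_nonneg ((h : ℝ) + 2 * x)]
  · nlinarith [(Nat.cast_nonneg s.card : (0 : ℝ) ≤ s.card)]

/-- Weighted Cauchy–Schwarz for two trigonometric polynomials. -/
lemma integral_norm_trigSum_mul_le {C : ℝ}
    (hC : ∀ s : Finset ℤ, ∫ β : ℝ, (1 + β ^ 2)⁻¹ * ‖trigSum s β‖ ^ 2 ≤ C * s.card)
    (s t : Finset ℤ) :
    ∫ β : ℝ, (1 + β ^ 2)⁻¹ * (‖trigSum s β‖ * ‖trigSum t β‖) ≤
      C * (√s.card * √t.card) := by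
  rcases s.eq_empty_or_nonempty with rfl | hs
  · simp [trigSum]
  rcases t.eq_empty_or_nonempty with rfl | ht
  · simp [trigSum]
  set p : ℝ := √s.card with hp
  set q : ℝ := √t.card with hq
  have hp0 : 0 < p := sqrt_pos.2 (by exact_mod_cast hs.card_pos)
  have hq0 : 0 < q := sqrt_pos.2 (by exact_mod_cast ht.card_pos)
  have hp2 : p ^ 2 = s.card := sq_sqrt (Nat.cast_nonneg _)
  have hq2 : q ^ 2 = t.card := sq_sqrt (Nat.cast_nonneg _)
  have hi1 := (integrable_inv_one_add_sq_mul_norm_trigSum_sq s).const_mul (q / (2 * p))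
  have hi2 := (integrable_inv_one_add_sq_mul_norm_trigSum_sq t).const_mul (p / (2 * q))
  calc ∫ β : ℝ, (1 + β ^ 2)⁻¹ * (‖trigSum s β‖ * ‖trigSum t β‖)
      ≤ ∫ β : ℝ, (q / (2 * p) * ((1 + β ^ 2)⁻¹ * ‖trigSum s β‖ ^ 2) +
          p / (2 * q) * ((1 + β ^ 2)⁻¹ * ‖trigSum t β‖ ^ 2)) := by
        refine integral_mono_of_nonneg (Filter.Eventually.of_forall fun β => by positivity)
          (hi1.add hi2) (Filter.Eventually.of_forall fun β => ?_)
        simp only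
        rw [show ∀ a x y : ℝ, q / (2 * p) * (a * x) + p / (2 * q) * (a * y) =
          a * (q / (2 * p) * x + p / (2 * q) * y) by intros; ring]
        gcongr
        have h : ∀ x y : ℝ, x * y ≤ q / (2 * p) * x ^ 2 + p / (2 * q) * y ^ 2 := fun x y => by
          have : q / (2 * p) * x ^ 2 + p / (2 * q) * y ^ 2 - x * y =
              (q * x - p * y) ^ 2 / (2 * p * q) := by
            field_simp
            ring
          have h2 : 0 ≤ (q * x - p * y) ^ 2 / (2 * p * q) := by positivity
          linarith
        exact h _ _
    _ = q / (2 * p) * (∫ β : ℝ, (1 + β ^ 2)⁻¹ * ‖trigSum s β‖ ^ 2) +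
          p / (2 * q) * (∫ β : ℝ, (1 + β ^ 2)⁻¹ * ‖trigSum t β‖ ^ 2) := by
        rw [integral_add hi1 hi2, integral_const_mul, integral_const_mul]
    _ ≤ q / (2 * p) * (C * p ^ 2) + p / (2 * q) * (C * q ^ 2) := by
        rw [hp2, hq2]
        gcongr
        · exact hC s
        · exact hC t
    _ = C * (p * q) := by
        field_simp
        ring

lemma sum_sub_integral_eq {c : ℝ} (hc : 0 ≤ c) (X : ℕ) {φ : ℝ → ℝ} {Φ : ℝ → ℂ}
    (hΦ : Continuous Φ) (hΦi : Integrable Φ)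
    (hinv : ∀ t, (φ t : ℂ) = ∫ β, Φ β * expTwoPi (β * t)) (k : ℝ) :
    Integrable (fun β => Φ β * (powSum c X β - powInt c X β) * expTwoPi (-(β * k))) ∧
    ((∑ m ∈ Ico X (16 * X), φ ((m : ℝ) ^ c - k) -
        ∫ u in (X : ℝ)..(16 * X : ℕ), φ (u ^ c - k) : ℝ) : ℂ) =
      ∫ β, Φ β * (powSum c X β - powInt c X β) * expTwoPi (-(β * k)) := by
  have hle : (X : ℝ) ≤ ((16 * X : ℕ) : ℝ) := by exact_mod_cast (by omega : X ≤ 16 * X)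
  set G : ℝ → ℝ → ℂ := fun u β => Φ β * expTwoPi (β * (u ^ c - k)) with hG
  have hGsplit : ∀ u β, G u β = Φ β * expTwoPi (-(β * k)) * expTwoPi (β * u ^ c) := fun u β => by
    rw [hG]
    simp only
    rw [mul_sub, sub_eq_add_neg, expTwoPi_add]
    ring
  have hGcont : Continuous fun p : ℝ × ℝ => G p.1 p.2 := by
    refine (hΦ.comp continuous_snd).mul (continuous_expTwoPi.comp ?_)
    exact continuous_snd.mul
      (((continuous_rpow_const hc).comp continuous_fst).sub continuous_const)
  have hGnorm : ∀ u β, ‖G u β‖ = ‖Φ β‖ := fun u β => by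
    simp [hG, norm_expTwoPi]
  have hGi : ∀ u, Integrable (G u) := fun u =>
    hΦi.norm.mono' ((hGcont.comp (Continuous.prodMk_right u)).aestronglyMeasurable)
      (Filter.Eventually.of_forall fun β => (hGnorm u β).le)
  have hGprod : Integrable (Function.uncurry G)
      ((volume.restrict (Set.Ioc (X : ℝ) ((16 * X : ℕ) : ℝ))).prod volume) := by
    refine (hΦi.norm.comp_snd (volume.restrict (Set.Ioc (X : ℝ) ((16 * X : ℕ) : ℝ)))).mono'
      hGcont.aestronglyMeasurable (Filter.Eventually.of_forall fun p => ?_)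
    exact (hGnorm p.1 p.2).le
  have hS : ∀ β, ∑ m ∈ Ico X (16 * X), G m β =
      Φ β * powSum c X β * expTwoPi (-(β * k)) := fun β => by
    rw [powSum, mul_assoc, mul_comm (∑ m ∈ _, _), ← mul_assoc, mul_sum]
    exact sum_congr rfl fun m _ => hGsplit m β
  have hI : ∀ β, ∫ u in Set.Ioc (X : ℝ) ((16 * X : ℕ) : ℝ), G u β =
      Φ β * powInt c X β * expTwoPi (-(β * k)) := fun β => by
    simp_rw [hGsplit]
    rw [integral_const_mul, powInt, intervalIntegral.integral_of_le hle]
    ring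
  have hSi : Integrable fun β => ∑ m ∈ Ico X (16 * X), G m β :=
    integrable_finsetSum _ fun m _ => hGi m
  have hIi : Integrable fun β => ∫ u in Set.Ioc (X : ℝ) ((16 * X : ℕ) : ℝ), G u β :=
    hGprod.integral_prod_right
  have hfun : (fun β => Φ β * (powSum c X β - powInt c X β) * expTwoPi (-(β * k))) =
      fun β => ∑ m ∈ Ico X (16 * X), G m β -
        ∫ u in Set.Ioc (X : ℝ) ((16 * X : ℕ) : ℝ), G u β := by
    funext β
    rw [hS, hI]
    ring
  rw [hfun]
  refine ⟨hSi.sub hIi, ?_⟩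
  rw [integral_sub hSi hIi, integral_finsetSum (f := fun m : ℕ => G m) _ (fun m _ => hGi m),
    ← integral_integral_swap hGprod]
  rw [Complex.ofReal_sub, Complex.ofReal_sum]
  congr 1
  · exact sum_congr rfl fun m _ => hinv _
  · rw [← intervalIntegral.integral_ofReal, intervalIntegral.integral_of_le hle]
    exact integral_congr_ae (Filter.Eventually.of_forall fun u => hinv _)

/-- On average over `n ∈ E`, `a ∈ A`, the smoothed count is close to its expected value. -/
lemma norm_sum_sum_sub_integral_le {c : ℝ} (hc : 0 ≤ c) {X : ℕ} {φ : ℝ → ℝ} {Φ : ℝ → ℂ}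
    (hΦ : Continuous Φ) (hΦi : Integrable Φ)
    (hinv : ∀ t, (φ t : ℂ) = ∫ β, Φ β * expTwoPi (β * t)) {C₁ C₂ C₃ : ℝ}
    (hC₁ : 0 < C₁) (hC₂ : 0 < C₂)
    (hdecay : ∀ β, (1 + |β|) * ‖Φ β‖ ≤ C₁ * (1 + β ^ 2)⁻¹)
    (hexp : ∀ β, ‖powSum c X β - powInt c X β‖ ≤ C₂ * (1 + |β|) * (X : ℝ) ^ (c / 2))
    (hms : ∀ s : Finset ℤ, ∫ β : ℝ, (1 + β ^ 2)⁻¹ * ‖trigSum s β‖ ^ 2 ≤ C₃ * s.card)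
    (E A : Finset ℤ) :
    |∑ n ∈ E, ∑ a ∈ A, (∑ m ∈ Ico X (16 * X), φ ((m : ℝ) ^ c - (n - a)) -
        ∫ u in (X : ℝ)..(16 * X : ℕ), φ (u ^ c - (n - a)))| ≤
      C₁ * C₂ * C₃ * (X : ℝ) ^ (c / 2) * (√E.card * √A.card) := by
  have hid := fun k => sum_sub_integral_eq hc X hΦ hΦi hinv k
  have h1 : ((∑ n ∈ E, ∑ a ∈ A, (∑ m ∈ Ico X (16 * X), φ ((m : ℝ) ^ c - (n - a)) -
        ∫ u in (X : ℝ)..(16 * X : ℕ), φ (u ^ c - (n - a))) : ℝ) : ℂ) =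
      ∫ β, Φ β * (powSum c X β - powInt c X β) *
        ((starRingEnd ℂ) (trigSum E β) * trigSum A β) := by
    rw [Complex.ofReal_sum]
    simp_rw [Complex.ofReal_sum, (hid _).2]
    simp_rw [← integral_finsetSum A (fun a _ => (hid _).1)]
    rw [← integral_finsetSum E (fun n _ => integrable_finsetSum A (fun a _ => (hid _).1))]
    refine integral_congr_ae (Filter.Eventually.of_forall fun β => ?_)
    simp only
    rw [trigSum, trigSum, map_sum, sum_mul_sum, mul_sum]
    refine sum_congr rfl fun n _ => ?_
    rw [mul_sum]
    refine sum_congr rfl fun a _ => ?_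
    rw [← expTwoPi_neg, ← expTwoPi_add]
    ring_nf
  rw [← norm_eq_abs, ← Complex.norm_real, h1]
  set W : ℝ := C₁ * C₂ * (X : ℝ) ^ (c / 2) with hW
  have hbound : ∀ β, ‖Φ β * (powSum c X β - powInt c X β) *
      ((starRingEnd ℂ) (trigSum E β) * trigSum A β)‖ ≤
        W * ((1 + β ^ 2)⁻¹ * (‖trigSum E β‖ * ‖trigSum A β‖)) := fun β => by
    rw [norm_mul, norm_mul, norm_mul, RCLike.norm_conj]
    calc ‖Φ β‖ * ‖powSum c X β - powInt c X β‖ * (‖trigSum E β‖ * ‖trigSum A β‖)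
        ≤ ‖Φ β‖ * (C₂ * (1 + |β|) * (X : ℝ) ^ (c / 2)) * (‖trigSum E β‖ * ‖trigSum A β‖) := by
          gcongr
          exact hexp β
      _ = C₂ * (X : ℝ) ^ (c / 2) * ((1 + |β|) * ‖Φ β‖) * (‖trigSum E β‖ * ‖trigSum A β‖) := by
          ring
      _ ≤ C₂ * (X : ℝ) ^ (c / 2) * (C₁ * (1 + β ^ 2)⁻¹) * (‖trigSum E β‖ * ‖trigSum A β‖) := by
          exact mul_le_mul_of_nonneg_right
            (mul_le_mul_of_nonneg_left (hdecay β) (by positivity)) (by positivity)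
      _ = _ := by rw [hW]; ring
  have hinteg : Integrable fun β : ℝ =>
      W * ((1 + β ^ 2)⁻¹ * (‖trigSum E β‖ * ‖trigSum A β‖)) := by
    refine Integrable.const_mul ?_ W
    refine (integrable_inv_one_add_sq.mul_const ((E.card : ℝ) * A.card)).mono' ?_
      (Filter.Eventually.of_forall fun β => ?_)
    · refine Continuous.aestronglyMeasurable (Continuous.mul ?_
        ((continuous_trigSum E).norm.mul (continuous_trigSum A).norm))
      exact Continuous.inv₀ (by fun_prop) fun β => by positivity
    · rw [norm_eq_abs, abs_of_nonneg (by positivity)]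
      gcongr
      · exact norm_trigSum_le E β
      · exact norm_trigSum_le A β
  refine (norm_integral_le_of_norm_le hinteg (Filter.Eventually.of_forall hbound)).trans ?_
  rw [integral_const_mul]
  calc W * ∫ β : ℝ, (1 + β ^ 2)⁻¹ * (‖trigSum E β‖ * ‖trigSum A β‖)
      ≤ W * (C₃ * (√E.card * √A.card)) := by
        gcongr
        exact integral_norm_trigSum_mul_le hms E A
    _ = _ := by rw [hW]; ring

/-- The expected value of the smoothed count is at least of order `X ^ (1 - c)`. -/
lemma le_integral_bump {c : ℝ} (hc1 : 1 < c) (hc2 : c < 3 / 2) {X : ℕ} (hX : 0 < X) {φ : ℝ → ℝ}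
    (hφ : Continuous φ) (hφ0 : ∀ t, 0 ≤ φ t) (hφ1 : ∀ t, |t - 1 / 2| ≤ 1 / 8 → φ t = 1) {k : ℝ}
    (hk1 : (2 * X : ℝ) ^ c ≤ k) (hk2 : k ≤ (8 * X : ℝ) ^ c) :
    (X : ℝ) ^ (1 - c) / 48 ≤ ∫ u in (X : ℝ)..(16 * X : ℕ), φ (u ^ c - k) := by
  have hX1 : (1 : ℝ) ≤ X := by exact_mod_cast hX
  have hX0 : (0 : ℝ) < X := by linarith
  have hc0 : 0 < c := by linarith
  have h16 : (16 : ℝ) ^ (c - 1) ≤ 4 := by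
    calc (16 : ℝ) ^ (c - 1) ≤ 16 ^ (1 / 2 : ℝ) :=
          rpow_le_rpow_of_exponent_le (by norm_num) (by linarith)
      _ = 4 := by
        rw [show (16 : ℝ) = 4 ^ (2 : ℝ) by norm_num, ← rpow_mul (by norm_num)]
        norm_num
  set r : ℝ := (X : ℝ) ^ (1 - c) / 48 with hr
  have hr0 : 0 < r := by positivity
  have hr1 : r ≤ 1 := by
    have : (X : ℝ) ^ (1 - c) ≤ 1 := rpow_le_one_of_one_le_of_nonpos hX1 (by linarith)
    rw [hr]
    linarith
  have hk0 : 0 ≤ k := le_trans (by positivity) hk1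
  set u₀ : ℝ := (k + 1 / 2) ^ c⁻¹ with hu₀
  have hu₀c : u₀ ^ c = k + 1 / 2 := rpow_inv_rpow (by linarith) hc0.ne'
  have hu₀0 : 0 ≤ u₀ := by positivity
  have hlow : 2 * (X : ℝ) ≤ u₀ := by
    rw [← rpow_le_rpow_iff (by positivity) hu₀0 hc0, hu₀c]
    linarith
  have hup : u₀ ≤ 16 * (X : ℝ) := by
    rw [← rpow_le_rpow_iff hu₀0 (by positivity) hc0, hu₀c]
    have h1 := Real.add_rpow_le_rpow_add (a := 8 * (X : ℝ)) (b := 8 * X) (by positivity)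
      (by positivity) hc1.le
    have h2 : 1 ≤ (8 * X : ℝ) ^ c := one_le_rpow (by linarith) hc0.le
    rw [show 8 * (X : ℝ) + 8 * X = 16 * X by ring] at h1
    linarith
  have hone : ∀ u ∈ Set.Icc (u₀ - r) u₀, φ (u ^ c - k) = 1 := by
    rintro u ⟨hu1, hu2⟩
    have hu0 : 0 < u := by linarith
    refine hφ1 _ ?_
    rcases hu2.eq_or_lt with h | h
    · rw [h, hu₀c]
      norm_num
    · obtain ⟨ξ, hξ1, hξ2, hξ⟩ := exists_rpow_sub_rpow_eq c hu0 h
      have hξ0 : 0 < ξ := hu0.trans hξ1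
      have h1 : ξ ^ (c - 1) ≤ 4 * (X : ℝ) ^ (c - 1) := by
        calc ξ ^ (c - 1) ≤ (16 * X : ℝ) ^ (c - 1) :=
              rpow_le_rpow hξ0.le (by linarith) (by linarith)
          _ = 16 ^ (c - 1) * (X : ℝ) ^ (c - 1) := mul_rpow (by norm_num) hX0.le
          _ ≤ _ := by gcongr
      have h2 : u₀ ^ c - u ^ c ≤ 1 / 8 := by
        calc u₀ ^ c - u ^ c = c * ξ ^ (c - 1) * (u₀ - u) := hξ
          _ ≤ 3 / 2 * (4 * (X : ℝ) ^ (c - 1)) * r := by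
            gcongr
            linarith
          _ = 1 / 8 * ((X : ℝ) ^ (c - 1) * (X : ℝ) ^ (1 - c)) := by rw [hr]; ring
          _ = 1 / 8 := by rw [← rpow_add hX0]; simp
      have h3 : u ^ c ≤ u₀ ^ c := rpow_le_rpow hu0.le hu2 hc0.le
      rw [abs_le]
      constructor <;> linarith
  have hcont : Continuous fun u : ℝ => φ (u ^ c - k) :=
    hφ.comp ((continuous_rpow_const hc0.le).sub continuous_const)
  calc r = ∫ _ in (u₀ - r)..u₀, (1 : ℝ) := by simp
    _ = ∫ u in (u₀ - r)..u₀, φ (u ^ c - k) := by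
      refine intervalIntegral.integral_congr fun u hu => ?_
      rw [Set.uIcc_of_le (by linarith)] at hu
      exact (hone u hu).symm
    _ ≤ _ := intervalIntegral.integral_mono_interval (by linarith) (by linarith)
      (by push_cast; exact hup) (Filter.Eventually.of_forall fun u => hφ0 _)
      (hcont.intervalIntegrable _ _)

lemma floor_rpow_strictMono {c : ℝ} (hc : 1 ≤ c) : StrictMono fun m : ℕ => ⌊(m : ℝ) ^ c⌋ := by
  refine strictMono_nat_of_lt_succ fun m => ?_
  have h := Real.add_rpow_le_rpow_add (a := (m : ℝ)) (b := 1) (by positivity) zero_le_one hc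
  rw [one_rpow] at h
  rw [Int.lt_iff_add_one_le, Int.le_floor]
  push_cast
  linarith [Int.floor_le ((m : ℝ) ^ c)]

/-- `n` is a sum `⌊m ^ c⌋ + ⌊p ^ c⌋` with `m` positive and `p` prime. -/
def IsFloorPowSum (c : ℝ) (n : ℕ) : Prop :=
  ∃ m p : ℕ, 0 < m ∧ p.Prime ∧ ⌊(m : ℝ) ^ c⌋ + ⌊(p : ℝ) ^ c⌋ = (n : ℤ)

lemma exists_card_mul_primeCounting_le {c : ℝ} (hc1 : 1 < c) (hc2 : c < 3 / 2) :
    ∃ C : ℝ, 0 < C ∧ ∀ X : ℕ, 0 < X → ∀ E : Finset ℕ,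
      (∀ n ∈ E, (4 * X : ℝ) ^ c ≤ n ∧ (n : ℝ) ≤ (8 * X : ℝ) ^ c ∧ ¬IsFloorPowSum c n) →
      (E.card : ℝ) * Nat.primeCounting (2 * X) ≤ C * (X : ℝ) ^ (3 * c - 2) := by
  obtain ⟨φ, Φ, C₁, hC₁, hφ, hφ0, hφs, hφ1, hΦ, hΦi, hdecay, hinv⟩ := exists_bump
  obtain ⟨C₂, hC₂, hexp⟩ := exists_norm_powSum_sub_powInt_le hc1 hc2
  obtain ⟨C₃, hC₃, hms⟩ := exists_integral_norm_trigSum_sq_le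
  set K : ℝ := C₁ * C₂ * C₃ with hK
  have hK0 : 0 < K := by positivity
  have hc0 : 0 < c := by linarith
  refine ⟨(48 * K) ^ 2, by positivity, fun X hX E hE => ?_⟩
  have hX0 : (0 : ℝ) < X := by exact_mod_cast hX
  set A : Finset ℤ := (Nat.primesLE (2 * X)).image fun p : ℕ => ⌊(p : ℝ) ^ c⌋ with hA
  have hAcard : A.card = Nat.primeCounting (2 * X) := by
    rw [hA, card_image_of_injective _ (floor_rpow_strictMono hc1.le).injective,
      Nat.primesLE_card_eq_primeCounting]
  set F : Finset ℤ := E.image fun n : ℕ => (n : ℤ) with hF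
  have hFcard : F.card = E.card := card_image_of_injective _ Nat.cast_injective
  have hkey := norm_sum_sum_sub_integral_le hc0.le hΦ hΦi hinv hC₁ hC₂ hdecay (hexp X hX) hms F A
  set r : ℝ := (X : ℝ) ^ (1 - c) / 48 with hr
  have hr0 : 0 < r := by positivity
  have hterm : ∀ n ∈ F, ∀ a ∈ A, (∑ m ∈ Ico X (16 * X), φ ((m : ℝ) ^ c - (n - a)) -
      ∫ u in (X : ℝ)..(16 * X : ℕ), φ (u ^ c - (n - a))) ≤ -r := by
    intro n' hn' a ha
    rw [hF, mem_image] at hn'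
    obtain ⟨n, hn, rfl⟩ := hn'
    rw [hA, mem_image] at ha
    obtain ⟨p, hp, rfl⟩ := ha
    rw [Nat.mem_primesLE] at hp
    obtain ⟨hn1, hn2, hn3⟩ := hE n hn
    have hzero : ∑ m ∈ Ico X (16 * X), φ ((m : ℝ) ^ c - (((n : ℤ) : ℝ) - ⌊(p : ℝ) ^ c⌋)) = 0 := by
      refine sum_eq_zero fun m hm => ?_
      by_contra hne
      obtain ⟨h1, h2⟩ := hφs _ hne
      refine hn3 ⟨m, p, by have := (mem_Ico.1 hm).1; omega, hp.2, ?_⟩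
      have : ⌊(m : ℝ) ^ c⌋ = (n : ℤ) - ⌊(p : ℝ) ^ c⌋ := by
        rw [Int.floor_eq_iff]
        push_cast at h1 h2 ⊢
        constructor <;> linarith
      omega
    have hpc : (⌊(p : ℝ) ^ c⌋ : ℝ) ≤ (2 * X : ℝ) ^ c := by
      refine (Int.floor_le _).trans (rpow_le_rpow (by positivity) ?_ hc0.le)
      exact_mod_cast hp.1
    have hp0 : (0 : ℝ) ≤ ⌊(p : ℝ) ^ c⌋ := by
      exact_mod_cast Int.floor_nonneg.2 (by positivity)
    have h4 : (2 * X : ℝ) ^ c + (2 * X : ℝ) ^ c ≤ (4 * X : ℝ) ^ c := by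
      have h := Real.add_rpow_le_rpow_add (a := 2 * (X : ℝ)) (b := 2 * X) (by positivity)
        (by positivity) hc1.le
      rwa [show 2 * (X : ℝ) + 2 * X = 4 * X by ring] at h
    have hI := le_integral_bump hc1 hc2 hX hφ hφ0 hφ1
      (k := ((n : ℤ) : ℝ) - ⌊(p : ℝ) ^ c⌋) (by push_cast; linarith) (by push_cast; linarith)
    rw [hzero]
    linarith
  have hsum : (F.card : ℝ) * A.card * r ≤ K * (X : ℝ) ^ (c / 2) * (√F.card * √A.card) := by
    refine le_trans ?_ hkey
    rw [le_abs]
    right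
    rw [le_neg]
    calc _ ≤ ∑ n ∈ F, ∑ a ∈ A, (-r) := sum_le_sum fun n hn => sum_le_sum fun a ha => hterm n hn a ha
      _ = _ := by simp; ring
  rw [hFcard, hAcard] at hsum
  set P : ℝ := (E.card : ℝ) * Nat.primeCounting (2 * X) with hP
  have hP0 : 0 ≤ P := by positivity
  rw [← sqrt_mul (by positivity)] at hsum
  have hsq : √P ≤ 48 * K * (X : ℝ) ^ (c / 2 + c - 1) := by
    rcases hP0.eq_or_lt with h | h
    · rw [← h, sqrt_zero]
      positivity
    · have h1 : √P * √P * r ≤ K * (X : ℝ) ^ (c / 2) * √P := by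
        rwa [mul_self_sqrt hP0]
      have h2 : √P * r ≤ K * (X : ℝ) ^ (c / 2) := by
        refine le_of_mul_le_mul_right ?_ (sqrt_pos.2 h)
        linarith
      rw [← le_div_iff₀ hr0] at h2
      refine h2.trans_eq ?_
      rw [hr, show c / 2 + c - 1 = c / 2 - (1 - c) by ring, rpow_sub hX0 (c / 2)]
      ring
  calc P = √P ^ 2 := (sq_sqrt hP0).symm
    _ ≤ (48 * K * (X : ℝ) ^ (c / 2 + c - 1)) ^ 2 := by gcongr
    _ = (48 * K) ^ 2 * (X : ℝ) ^ (3 * c - 2) := by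
      rw [mul_pow, ← rpow_natCast ((X : ℝ) ^ _), ← rpow_mul hX0.le]
      congr 2
      push_cast
      ring

/-- A weak form of Chebyshev's lower bound for the prime counting function. -/
lemma mul_rpow_le_primeCounting {n : ℕ} (hn : 2 ≤ n) {η : ℝ} (hη : 0 < η) :
    η / 10 * (n : ℝ) ^ (1 - η) ≤ Nat.primeCounting n := by
  have hn2 : (2 : ℝ) ≤ n := by exact_mod_cast hn
  have hn0 : (0 : ℝ) < n := by linarith
  have hlog : 0 < log n := log_pos (by linarith)
  refine le_trans ?_ (Chebyshev.pi_ge n)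
  rw [le_div_iff₀ hlog]
  have h1 : log n ≤ (n : ℝ) ^ η / η := log_le_rpow_div hn0.le hη
  have h2 : log ((n : ℝ) + 1) ≤ ((n : ℝ) + 1) / 4 - 1 + 2 * log 2 := by
    have h := log_le_sub_one_of_pos (x := ((n : ℝ) + 1) / 4) (by positivity)
    rw [log_div (by positivity) (by norm_num), show (4 : ℝ) = 2 ^ 2 by norm_num, log_pow] at h
    push_cast at h
    linarith
  calc η / 10 * (n : ℝ) ^ (1 - η) * log n
      ≤ η / 10 * (n : ℝ) ^ (1 - η) * ((n : ℝ) ^ η / η) := by gcongr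
    _ = (n : ℝ) ^ (1 - η) * (n : ℝ) ^ η / 10 := by field_simp
    _ = n / 10 := by rw [← rpow_add hn0]; simp
    _ ≤ n * log 2 - log (n + 1) := by
      nlinarith [log_two_gt_d9]

lemma exists_card_le {c ε : ℝ} (hc1 : 1 < c) (hc2 : c < 3 / 2) (hε : 0 < ε) :
    ∃ C : ℝ, 0 < C ∧ ∀ X : ℕ, 0 < X → ∀ E : Finset ℕ,
      (∀ n ∈ E, (4 * X : ℝ) ^ c ≤ n ∧ (n : ℝ) ≤ (8 * X : ℝ) ^ c ∧ ¬IsFloorPowSum c n) →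
      (E.card : ℝ) ≤ C * (X : ℝ) ^ (c * (3 * (1 - 1 / c) + ε)) := by
  obtain ⟨C, hC, h⟩ := exists_card_mul_primeCounting_le hc1 hc2
  have hc0 : 0 < c := by linarith
  set η : ℝ := min (c * ε) (1 / 2) with hη
  have hη0 : 0 < η := lt_min (by positivity) (by norm_num)
  have hη1 : η ≤ c * ε := min_le_left _ _
  have hη2 : η ≤ 1 / 2 := min_le_right _ _
  refine ⟨C * 10 / η, by positivity, fun X hX E hE => ?_⟩
  have hX1 : (1 : ℝ) ≤ X := by exact_mod_cast hX
  have hX0 : (0 : ℝ) < X := by linarith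
  have hπ : η / 10 * (X : ℝ) ^ (1 - η) ≤ Nat.primeCounting (2 * X) := by
    refine le_trans ?_ (mul_rpow_le_primeCounting (by omega) hη0)
    gcongr
    · linarith
    · omega
  have h1 : (E.card : ℝ) * (η / 10 * (X : ℝ) ^ (1 - η)) ≤ C * (X : ℝ) ^ (3 * c - 2) :=
    le_trans (by gcongr) (h X hX E hE)
  rw [← le_div_iff₀ (by positivity)] at h1
  calc (E.card : ℝ) ≤ _ := h1
    _ = C * 10 / η * (X : ℝ) ^ (3 * c - 3 + η) := by
      rw [show 3 * c - 3 + η = 3 * c - 2 - (1 - η) by ring, rpow_sub hX0 (3 * c - 2)]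
      ring
    _ ≤ _ := by
      have : 3 * c - 3 + η ≤ c * (3 * (1 - 1 / c) + ε) := by
        have : c * (3 * (1 - 1 / c) + ε) = 3 * c - 3 + c * ε := by field_simp
        linarith
      gcongr

/-- Passing from blocks `[4X, 8X]` to initial segments by dyadic decomposition. -/
lemma exists_ncard_dyadic_le {c ε : ℝ} (hc1 : 1 < c) (hc2 : c < 3 / 2) (hε : 0 < ε) :
    ∃ K : ℝ, 0 < K ∧ ∀ J : ℕ,
      ({n : ℕ | (n : ℝ) ≤ (8 * 2 ^ J : ℝ) ^ c ∧ ¬IsFloorPowSum c n}.ncard : ℝ) ≤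
        K * ((2 : ℝ) ^ J) ^ (c * (3 * (1 - 1 / c) + ε)) := by
  obtain ⟨C, hC, h⟩ := exists_card_le hc1 hc2 hε
  set θ : ℝ := c * (3 * (1 - 1 / c) + ε) with hθ
  have hθ0 : 0 < θ := by
    have : 1 / c < 1 := by rw [div_lt_one (by linarith)]; exact hc1
    have : 0 < 3 * (1 - 1 / c) + ε := by linarith
    positivity
  set S : ℕ → Set ℕ := fun J => {n : ℕ | (n : ℝ) ≤ (8 * 2 ^ J : ℝ) ^ c ∧ ¬IsFloorPowSum c n}
    with hS
  have hfin : ∀ J, (S J).Finite := fun J =>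
    (Set.finite_Iic ⌊(8 * 2 ^ J : ℝ) ^ c⌋₊).subset fun n hn => Nat.le_floor hn.1
  set q : ℝ := 2 ^ θ with hq
  have hq1 : 1 < q := one_lt_rpow (by norm_num) hθ0
  set K : ℝ := (S 0).ncard + C * q / (q - 1) with hK
  have hq0 : 0 < q - 1 := by linarith
  have hKC : C * q ≤ K * (q - 1) := by
    rw [hK, add_mul, div_mul_cancel₀ _ hq0.ne']
    have : 0 ≤ ((S 0).ncard : ℝ) * (q - 1) := by positivity
    linarith
  have hpow : ∀ J : ℕ, ((2 : ℝ) ^ J) ^ θ = q ^ J := fun J => by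
    rw [hq, ← rpow_natCast, ← rpow_natCast, ← rpow_mul (by norm_num), ← rpow_mul (by norm_num),
      mul_comm]
  refine ⟨K, by positivity, fun J => ?_⟩
  change ((S J).ncard : ℝ) ≤ _
  rw [hpow]
  induction J with
  | zero =>
    have : 0 < C * q / (q - 1) := by positivity
    rw [hK]
    linarith
  | succ J ih =>
    set T : Set ℕ := S (J + 1) \ S J with hT
    have hTfin : T.Finite := (hfin (J + 1)).sdiff
    have hsub : S (J + 1) ⊆ S J ∪ T := by
      rw [hT, Set.union_sdiff_self]
      exact Set.subset_union_right
    have hcard : (S (J + 1)).ncard ≤ (S J).ncard + T.ncard :=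
      (Set.ncard_le_ncard hsub ((hfin J).union hTfin)).trans (Set.ncard_union_le _ _)
    have hTcard : (T.ncard : ℝ) ≤ C * q ^ (J + 1) := by
      have h1 := h (2 ^ (J + 1)) (by positivity) hTfin.toFinset fun n hn => by
        rw [Set.Finite.mem_toFinset] at hn
        obtain ⟨⟨hn1, hn2⟩, hn3⟩ := hn
        push_cast
        refine ⟨?_, hn1, hn2⟩
        by_contra hlt
        refine hn3 ⟨?_, hn2⟩
        rw [pow_succ, show (4 : ℝ) * (2 ^ J * 2) = 8 * 2 ^ J by ring] at hlt
        exact (not_le.1 hlt).le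
      rw [← Set.ncard_eq_toFinset_card T hTfin] at h1
      push_cast at h1
      rwa [hpow] at h1
    calc ((S (J + 1)).ncard : ℝ) ≤ (S J).ncard + T.ncard := by exact_mod_cast hcard
      _ ≤ K * q ^ J + C * q ^ (J + 1) := by gcongr
      _ = (K + C * q) * q ^ J := by ring
      _ ≤ (K + K * (q - 1)) * q ^ J := by gcongr
      _ = K * q ^ (J + 1) := by ring

end

/-- For `1 < c < 3/2` and `ε > 0`, the number `E_c(x)` of positive integers `n ≤ x`
not representable as `⌊m^c⌋ + ⌊p^c⌋` with `m ≥ 1` and `p` prime satisfies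
`E_c(x) ≤ C · x^(3(1 - 1/c) + ε)` for all `x ≥ 2`. -/
theorem exceptional_set_bound (c ε : ℝ) (hc1 : 1 < c) (hc2 : c < 3 / 2) (hε : 0 < ε) :
    ∃ C : ℝ, ∀ x : ℝ, 2 ≤ x →
      (({n : ℕ | 0 < n ∧ (n : ℝ) ≤ x ∧ ¬∃ m p : ℕ, 0 < m ∧ p.Prime ∧
          ⌊(m : ℝ) ^ c⌋ + ⌊(p : ℝ) ^ c⌋ = (n : ℤ)}.ncard : ℝ) ≤
        C * x ^ (3 * (1 - 1 / c) + ε)) := by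
  obtain ⟨K, hK, h⟩ := exists_ncard_dyadic_le hc1 hc2 hε
  refine ⟨K, fun x hx => ?_⟩
  have hc0 : 0 < c := by linarith
  obtain ⟨J, hJ1, hJ2⟩ := exists_nat_pow_near (x := x) (y := (2 : ℝ) ^ c) (by linarith)
    (Real.one_lt_rpow (by norm_num) hc0)
  have hpow : ∀ i : ℕ, ((2 : ℝ) ^ c) ^ i = ((2 : ℝ) ^ i) ^ c := fun i => by
    rw [← Real.rpow_natCast, ← Real.rpow_natCast, ← Real.rpow_mul (by norm_num),
      ← Real.rpow_mul (by norm_num), mul_comm]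
  rw [hpow] at hJ1 hJ2
  have hθ : 0 ≤ 3 * (1 - 1 / c) + ε := by
    have : 1 / c < 1 := by rw [div_lt_one hc0]; exact hc1
    linarith
  have hx8 : x ≤ (8 * 2 ^ J : ℝ) ^ c := by
    refine hJ2.le.trans (Real.rpow_le_rpow (by positivity) ?_ hc0.le)
    rw [pow_succ]
    linarith [pow_pos (zero_lt_two (α := ℝ)) J]
  have hfin : {n : ℕ | (n : ℝ) ≤ (8 * 2 ^ J : ℝ) ^ c ∧ ¬IsFloorPowSum c n}.Finite :=
    (Set.finite_Iic ⌊(8 * 2 ^ J : ℝ) ^ c⌋₊).subset fun n hn => Nat.le_floor hn.1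
  have hsub : {n : ℕ | 0 < n ∧ (n : ℝ) ≤ x ∧ ¬∃ m p : ℕ, 0 < m ∧ p.Prime ∧
      ⌊(m : ℝ) ^ c⌋ + ⌊(p : ℝ) ^ c⌋ = (n : ℤ)} ⊆
        {n : ℕ | (n : ℝ) ≤ (8 * 2 ^ J : ℝ) ^ c ∧ ¬IsFloorPowSum c n} :=
    fun n hn => ⟨hn.2.1.trans hx8, hn.2.2⟩
  refine le_trans (Nat.cast_le.2 (Set.ncard_le_ncard hsub hfin)) ((h J).trans ?_)
  rw [Real.rpow_mul (by positivity)]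
  gcongr
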